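/- arXiv:1604.08808 — 3 statements merged into one kernel-verified Lean document; each statement's English description precedes it below -/
import Mathlib

section
/- Let (Y, 𝒜, μ) be a measure space, H := L²(μ), V a real Hilbert space, and ι : V → H an injective continuous linear map with dense range; for f ∈ H and v ∈ V write ⟨f, v⟩ := ⟨f, ιv⟩_H, so that H embeds into the dual V*. Let A : V → V* be a continuous linear operator. Let λ > 0 and let f : ℝ → ℝ be nondecreasing, Lipschitz continuous with constant 1/λ, and satisfy f(0) = 0, and define A_λ : V → V* by ⟨A_λ u, v⟩ := ⟨Au, v⟩ + ∫_Y f(ιu)·(ιv) dμ. Then A_λ is hemicontinuous and bounded: for all u, v, x ∈ V the map ℝ ∋ η ↦ ⟨A_λ(u + ηv), x⟩ is continuous, and ‖A_λ v‖_{V*} ≤ (‖A‖_{L(V,V*)} + k²/λ)‖v‖_V for all v ∈ V, where k is the operator norm of ι. -/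
open MeasureTheory

theorem LipschitzWith.integral_comp_mul_eq_inner_compLp {Y : Type*} [MeasurableSpace Y] {μ : Measure Y}
    {K : NNReal} {f : ℝ → ℝ} (hf : LipschitzWith K f) (hf0 : f 0 = 0) (g h : Lp ℝ 2 μ) :
    ∫ y, f (g y) * h y ∂μ = inner ℝ h (hf.compLp hf0 g) := by
  rw [L2.inner_def]
  refine integral_congr_ae ?_
  filter_upwards [hf.coeFn_compLp hf0 g] with y hy
  rw [hy]
  rfl

/-- the perturbed operator `A_λ u := A u + f(ιu)·(ι·) dμ` is
hemicontinuous and bounded with `‖A_λ v‖_{V*} ≤ (‖A‖ + k²/λ)‖v‖`. -/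
theorem stmt4
    {Y : Type*} [MeasurableSpace Y] (μ : Measure Y)
    {V : Type*} [NormedAddCommGroup V] [InnerProductSpace ℝ V] [CompleteSpace V]
    (ι : V →L[ℝ] Lp ℝ 2 μ) (hι : Function.Injective ι) (hdense : DenseRange ι)
    (A : V →L[ℝ] (V →L[ℝ] ℝ))
    (lam : ℝ) (hlam : 0 < lam)
    (f : ℝ → ℝ) (hmono : Monotone f)
    (hlip : ∀ x y : ℝ, |f x - f y| ≤ (1 / lam) * |x - y|)
    (hf0 : f 0 = 0) :
    (∀ u v x : V, Continuous fun η : ℝ =>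
      A (u + η • v) x + ∫ y, f ((ι (u + η • v)) y) * (ι x) y ∂μ) ∧
    (∀ v x : V, |A v x + ∫ y, f ((ι v) y) * (ι x) y ∂μ| ≤
      (‖A‖ + ‖ι‖ ^ 2 / lam) * ‖v‖ * ‖x‖) := by
  have hf : LipschitzWith (1 / lam).toNNReal f :=
    LipschitzWith.of_dist_le_mul fun x y => by
      rw [Real.coe_toNNReal _ (by positivity), Real.dist_eq, Real.dist_eq]
      exact hlip x y
  simp only [hf.integral_comp_mul_eq_inner_compLp hf0]
  refine ⟨fun u v x => ?_, fun v x => ?_⟩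
  · have hcont : Continuous fun η : ℝ => hf.compLp hf0 (ι (u + η • v)) :=
      (hf.continuous_compLp hf0).comp (by fun_prop)
    exact (by fun_prop : Continuous fun η : ℝ => A (u + η • v) x).add
      (continuous_const.inner hcont)
  · have hcomp : ‖hf.compLp hf0 (ι v)‖ ≤ 1 / lam * (‖ι‖ * ‖v‖) := by
      refine (hf.norm_compLp_le hf0 (ι v)).trans ?_
      rw [Real.coe_toNNReal _ (by positivity)]
      gcongr
      exact ι.le_opNorm v
    calc |A v x + inner ℝ (ι x) (hf.compLp hf0 (ι v))|
        ≤ |A v x| + |inner ℝ (ι x) (hf.compLp hf0 (ι v))| := abs_add_le _ _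
      _ ≤ ‖A‖ * ‖v‖ * ‖x‖ + ‖ι‖ * ‖x‖ * (1 / lam * (‖ι‖ * ‖v‖)) := by
          refine add_le_add (A.le_opNorm₂ v x) ((abs_real_inner_le_norm _ _).trans ?_)
          gcongr
          exact ι.le_opNorm x
      _ = (‖A‖ + ‖ι‖ ^ 2 / lam) * ‖v‖ * ‖x‖ := by ring
end

section
/- Let E and F be real Banach spaces, N > 0, α ≥ 0, and let S : (0,∞) → L(E,F) be such that for each x ∈ E the map t ↦ S(t)x is strongly measurable and ‖S(t)‖_{L(E,F)} ≤ N t^{−α} for all t > 0. Let m ∈ ℕ with m ≥ 1 and m > α, and let λ > 0. Then for every x ∈ E the Bochner integral R x := (λ^m/(m−1)!) ∫_0^∞ t^{m−1} e^{−λt} S(t)x dt converges absolutely in F, the map R : E → F so defined is linear and bounded, and ‖R‖_{L(E,F)} ≤ N (Γ(m−α)/(m−1)!) λ^{α}, where Γ is the Gamma function. -/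
open MeasureTheory Real

/-- the Laplace-transform representation of powers of the
resolvent of a semigroup `S` with `‖S(t)‖ ≤ N t^(-α)` defines a bounded operator
with norm at most `N Γ(m-α)/(m-1)! λ^α`. -/
theorem stmt12
    {E F : Type*} [NormedAddCommGroup E] [NormedSpace ℝ E] [CompleteSpace E]
    [NormedAddCommGroup F] [NormedSpace ℝ F] [CompleteSpace F]
    (N α : ℝ) (hN : 0 < N) (hα : 0 ≤ α)
    (S : ℝ → E →L[ℝ] F)
    (hmeas : ∀ x : E, AEStronglyMeasurable (fun t => S t x)
      (volume.restrict (Set.Ioi (0 : ℝ))))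
    (hbound : ∀ t : ℝ, 0 < t → ‖S t‖ ≤ N * t ^ (-α))
    (m : ℕ) (hm1 : 1 ≤ m) (hmα : α < (m : ℝ)) (lam : ℝ) (hlam : 0 < lam) :
    (∀ x : E, IntegrableOn
      (fun t => (t ^ (m - 1) * Real.exp (-(lam * t))) • S t x) (Set.Ioi 0)) ∧
    ∃ R : E →L[ℝ] F,
      (∀ x : E, R x = (lam ^ m / (Nat.factorial (m - 1) : ℝ)) •
        ∫ t in Set.Ioi (0 : ℝ), (t ^ (m - 1) * Real.exp (-(lam * t))) • S t x) ∧
      ‖R‖ ≤ N * (Real.Gamma ((m : ℝ) - α) / (Nat.factorial (m - 1) : ℝ)) *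
        lam ^ α := by
  have hs : 0 < (m : ℝ) - α := sub_pos.2 hmα
  have hgamma : ∫ t in Set.Ioi (0 : ℝ), t ^ ((m : ℝ) - α - 1) * Real.exp (-(lam * t)) =
      (1 / lam) ^ ((m : ℝ) - α) * Real.Gamma ((m : ℝ) - α) :=
    Real.integral_rpow_mul_exp_neg_mul_Ioi hs hlam
  have hint : IntegrableOn (fun t : ℝ => t ^ ((m : ℝ) - α - 1) * Real.exp (-(lam * t)))
      (Set.Ioi 0) := by
    simpa using integrableOn_rpow_mul_exp_neg_mul_rpow (p := 1) (s := (m : ℝ) - α - 1) (b := lam)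
      (by linarith) one_pos hlam
  have hle : ∀ x : E, ∀ᵐ t ∂(volume.restrict (Set.Ioi (0 : ℝ))),
      ‖(t ^ (m - 1) * Real.exp (-(lam * t))) • S t x‖ ≤
        N * ‖x‖ * (t ^ ((m : ℝ) - α - 1) * Real.exp (-(lam * t))) := by
    intro x
    filter_upwards [ae_restrict_mem measurableSet_Ioi] with t ht
    have ht : 0 < t := ht
    have hpow : t ^ ((m : ℝ) - α - 1) = t ^ (m - 1) * t ^ (-α) := by
      rw [← Real.rpow_natCast, ← Real.rpow_add ht, Nat.cast_sub hm1]
      congr 1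
      push_cast
      ring
    rw [norm_smul, Real.norm_of_nonneg (by positivity), hpow]
    calc t ^ (m - 1) * Real.exp (-(lam * t)) * ‖S t x‖
        ≤ t ^ (m - 1) * Real.exp (-(lam * t)) * (N * t ^ (-α) * ‖x‖) := by
          gcongr
          exact (S t).le_of_opNorm_le (hbound t ht) x
      _ = _ := by ring
  have hI : ∀ x : E, IntegrableOn
      (fun t => (t ^ (m - 1) * Real.exp (-(lam * t))) • S t x) (Set.Ioi 0) := fun x =>
    (hint.const_mul (N * ‖x‖)).mono'
      ((by fun_prop : Continuous fun t : ℝ =>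
        t ^ (m - 1) * Real.exp (-(lam * t))).aestronglyMeasurable.smul (hmeas x)) (hle x)
  refine ⟨hI, ?_⟩
  let L : E →ₗ[ℝ] F :=
    { toFun := fun x => (lam ^ m / (Nat.factorial (m - 1) : ℝ)) •
        ∫ t in Set.Ioi (0 : ℝ), (t ^ (m - 1) * Real.exp (-(lam * t))) • S t x
      map_add' := fun x y => by
        simp only [map_add, smul_add]
        rw [integral_add (hI x) (hI y), smul_add]
      map_smul' := fun c x => by
        simp only [map_smul, RingHom.id_apply, smul_comm _ c, integral_smul] }
  have hL : ∀ x, ‖L x‖ ≤ N * (Real.Gamma ((m : ℝ) - α) / (Nat.factorial (m - 1) : ℝ)) *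
      lam ^ α * ‖x‖ := by
    intro x
    have hnorm := norm_integral_le_of_norm_le (hint.const_mul (N * ‖x‖)) (hle x)
    rw [integral_const_mul, hgamma] at hnorm
    have hlamα : lam ^ m * (1 / lam) ^ ((m : ℝ) - α) = lam ^ α := by
      rw [one_div, Real.inv_rpow hlam.le, ← Real.rpow_neg hlam.le, ← Real.rpow_natCast,
        ← Real.rpow_add hlam]
      congr 1
      ring
    change ‖(lam ^ m / (Nat.factorial (m - 1) : ℝ)) •
        ∫ t in Set.Ioi (0 : ℝ), (t ^ (m - 1) * Real.exp (-(lam * t))) • S t x‖ ≤ _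
    rw [norm_smul, Real.norm_of_nonneg (by positivity), ← hlamα]
    refine (mul_le_mul_of_nonneg_left hnorm (by positivity)).trans_eq ?_
    ring
  have hΓ := Real.Gamma_pos_of_pos hs
  exact ⟨L.mkContinuous _ hL, fun x => rfl, L.mkContinuous_norm_le (by positivity) hL⟩
end

section
/- Let E, F, F' be separable real Hilbert spaces and let (e_i)_{i∈ℕ} be a Hilbert basis of E. Let T : E → F be a Hilbert–Schmidt operator, i.e. a continuous linear operator with ∑_i ‖T e_i‖_F² < ∞. Let (L_n) be a sequence of continuous linear operators F → F' converging to a continuous linear operator L : F → F' in the strong operator topology, i.e. L_n y → L y in F' for every y ∈ F. Then L_n ∘ T → L ∘ T in Hilbert–Schmidt norm: ∑_i ‖L_n(T e_i) − L(T e_i)‖_{F'}² → 0 as n → ∞. -/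
open Filter

/-- post-composition of a Hilbert–Schmidt operator with a strongly
convergent sequence of operators converges in Hilbert–Schmidt norm. -/
theorem stmt14
    {E F F' : Type*}
    [NormedAddCommGroup E] [InnerProductSpace ℝ E] [CompleteSpace E]
    [NormedAddCommGroup F] [InnerProductSpace ℝ F] [CompleteSpace F]
    [NormedAddCommGroup F'] [InnerProductSpace ℝ F'] [CompleteSpace F']
    (e : HilbertBasis ℕ ℝ E)
    (T : E →L[ℝ] F) (hT : Summable fun i => ‖T (e i)‖ ^ 2)
    (L : ℕ → F →L[ℝ] F') (L₀ : F →L[ℝ] F')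
    (hL : ∀ y : F, Tendsto (fun n => L n y) atTop (nhds (L₀ y))) :
    (∀ n, Summable fun i => ‖L n (T (e i)) - L₀ (T (e i))‖ ^ 2) ∧
    Tendsto (fun n => ∑' i, ‖L n (T (e i)) - L₀ (T (e i))‖ ^ 2) atTop (nhds 0) := by
  obtain ⟨C, hC⟩ : ∃ C, ∀ n, ‖L n - L₀‖ ≤ C := by
    refine banach_steinhaus fun y => ?_
    obtain ⟨C, hC⟩ := ((hL y).sub_const (L₀ y)).norm.bddAbove_range
    exact ⟨C, fun n => hC ⟨n, rfl⟩⟩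
  have hbound : ∀ n i, ‖L n (T (e i)) - L₀ (T (e i))‖ ^ 2 ≤ C ^ 2 * ‖T (e i)‖ ^ 2 := by
    intro n i
    rw [← mul_pow]
    exact pow_le_pow_left₀ (norm_nonneg _) ((L n - L₀).le_of_opNorm_le (hC n) _) 2
  have hsum : Summable fun i => C ^ 2 * ‖T (e i)‖ ^ 2 := hT.mul_left _
  refine ⟨fun n => hsum.of_nonneg_of_le (fun i => sq_nonneg _) (hbound n), ?_⟩
  have hlim : ∀ i, Tendsto (fun n => ‖L n (T (e i)) - L₀ (T (e i))‖ ^ 2) atTop (nhds 0) := by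
    intro i
    simpa using (((hL (T (e i))).sub_const (L₀ (T (e i)))).norm.pow 2)
  simpa using tendsto_tsum_of_dominated_convergence hsum hlim
    (Eventually.of_forall fun n i => by simpa using hbound n i)
end
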